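/- Let X be a real Banach space and [·,·] : X × X → X a bilinear map with antisymmetry defect φ(x,y) := [x,y] + [y,x], satisfying ‖[x,y]‖ ≤ A·‖x‖·‖y‖ and ‖φ(x,y)‖ ≤ 2·C₁·‖x‖·‖y‖ for all x,y ∈ X, where A, C₁ ≥ 0. Let ε > 0 and let ω : X × X → X be a continuous bilinear map with ‖ω(x,y)‖ ≤ K·‖x‖·‖y‖ for all x,y. Let dω be its Chevalley–Eilenberg differential and define (T(dω))(x,y) := ∫_{t ∈ [0,1]} t²·(dω)(t·x, t·y, t·(x+y)) dt. Then for all x, y ∈ X with ‖x‖ ≤ ε and ‖y‖ ≤ ε, one has ‖(T(dω))(x,y)‖ ≤ 2·ε·(A + C₁)·K·‖x‖·‖y‖. -/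

import Mathlib

/-- Bound for `T(dω)`: with the Chevalley–Eilenberg differential `dω` of a continuous
bilinear cochain `ω` and the radial homotopy operator `T`, one has
`‖(T(dω))(x,y)‖ ≤ 2·ε·(A + C₁)·K·‖x‖·‖y‖` on the ball of radius `ε`. -/
theorem stmt9 {X : Type*} [NormedAddCommGroup X] [NormedSpace ℝ X] [CompleteSpace X]
    (B : X →ₗ[ℝ] X →ₗ[ℝ] X) (A C₁ ε K : ℝ) (hA : 0 ≤ A) (hC₁ : 0 ≤ C₁) (hε : 0 < ε)
    (hB : ∀ x y : X, ‖B x y‖ ≤ A * ‖x‖ * ‖y‖)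
    (hφ : ∀ x y : X, ‖B x y + B y x‖ ≤ 2 * C₁ * ‖x‖ * ‖y‖)
    (ω : X →L[ℝ] X →L[ℝ] X)
    (hω : ∀ x y : X, ‖ω x y‖ ≤ K * ‖x‖ * ‖y‖)
    (D : X → X → X → X)
    (hD : ∀ x y z : X, D x y z =
      B x (ω y z) - B y (ω x z) + B z (ω x y)
        - ω (B x y) z + ω (B x z) y - ω (B y z) x)
    (x y : X) (hx : ‖x‖ ≤ ε) (hy : ‖y‖ ≤ ε) :
    ‖∫ t in (0:ℝ)..1, t ^ 2 • D (t • x) (t • y) (t • (x + y))‖ ≤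
      2 * ε * (A + C₁) * K * ‖x‖ * ‖y‖ := by
  have hK : 0 ≤ K * ‖x‖ * ‖y‖ := (norm_nonneg _).trans (hω x y)
  have hcubic : ∀ t : ℝ, t ^ 2 • D (t • x) (t • y) (t • (x + y)) = t ^ 5 • D x y (x + y) := by
    intro t
    simp only [hD, map_smul, LinearMap.smul_apply, _root_.smul_apply]
    module
  have hint : ∫ t in (0:ℝ)..1, t ^ 2 • D (t • x) (t • y) (t • (x + y)) =
      (1 / 6 : ℝ) • D x y (x + y) := by
    simp only [hcubic]
    rw [intervalIntegral.integral_smul_const, integral_pow]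
    norm_num
  have hexp : D x y (x + y) = B x (ω y x + ω x y) + B x (ω y y) - B y (ω x x)
      - ω (B x y + B y x) x + ω (B x x) y - ω (B y y) x := by
    simp only [hD, map_add, LinearMap.add_apply, _root_.add_apply]
    abel
  have hdiag : ∀ v : X, ‖B v v‖ ≤ C₁ * ‖v‖ * ‖v‖ := by
    intro v
    have h := hφ v v
    rw [← two_smul ℝ (B v v), norm_smul, Real.norm_two] at h
    linarith
  rcases lt_or_ge K 0 with hneg | hnonneg
  · have hx0 : x = 0 := by
      by_contra h
      have hpos := norm_pos_iff.mpr h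
      have := (norm_nonneg _).trans (hω x x)
      nlinarith [mul_pos hpos hpos]
    simp [hx0, hD]
  · have hBω : ∀ u v w c, ‖v‖ ≤ c → ‖B u v‖ ≤ A * ‖u‖ * c ∧ ‖ω v w‖ ≤ K * c * ‖w‖ := by
      intro u v w c h
      exact ⟨(hB u v).trans (by gcongr), (hω v w).trans (by gcongr)⟩
    have h₁ := (hBω x _ 0 _ (norm_add_le_of_le (hω y x) (hω x y))).1
    have h₂ := (hBω x _ 0 _ (hω y y)).1
    have h₃ := (hBω y _ 0 _ (hω x x)).1
    have h₄ := (hBω 0 _ x _ (hφ x y)).2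
    have h₅ := (hBω 0 _ y _ (hdiag x)).2
    have h₆ := (hBω 0 _ x _ (hdiag y)).2
    have hnorm : ‖D x y (x + y)‖ ≤ (A + C₁) * (K * ‖x‖ * ‖y‖) * (3 * ‖x‖ + ‖y‖) := by
      rw [hexp]
      refine (norm_sub_le_of_le (norm_add_le_of_le (norm_sub_le_of_le (norm_sub_le_of_le
        (norm_add_le_of_le h₁ h₂) h₃) h₄) h₅) h₆).trans (le_of_eq ?_)
      ring
    have hbound : (A + C₁) * (K * ‖x‖ * ‖y‖) * (3 * ‖x‖ + ‖y‖) ≤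
        (A + C₁) * (K * ‖x‖ * ‖y‖) * (12 * ε) := by
      gcongr
      linarith
    rw [hint, norm_smul, Real.norm_of_nonneg (by norm_num)]
    linarith
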